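/- Let t0 ≥ 0, σ > 0, τ > 0, and let a, b, g, h : ℝ → ℝ be Lebesgue measurable with 0 ≤ t − g(t) ≤ σ and 0 ≤ t − h(t) ≤ τ for almost every t ≥ t0. Suppose there exist constants α > 0, A0 ∈ [0,1), B ≥ 0 and P ≥ 0 such that for almost every t ≥ t0: b(t) ≥ α, |a(t)| ≤ A0, |b(t)| ≤ B, |a(t)|/b(t) ≤ P, and that (P + τ)·B < 1 − A0. Then the neutral equation x'(t) − a(t)x'(g(t)) = −b(t)·x(h(t)) is uniformly exponentially stable for initial times in [t0,∞). -/

import Mathlib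

open MeasureTheory Real

/-- The extended derivative: `deriv x t` for `t ≥ s`, the prescribed initial
derivative `ψ t` for `t < s`. -/
noncomputable def Dfun (x ψ : ℝ → ℝ) (s : ℝ) : ℝ → ℝ :=
  fun t => if s ≤ t then deriv x t else ψ t

/-- A function `f : ℝ → ℝ` is (globally) bounded. -/
def Bdd (f : ℝ → ℝ) : Prop := ∃ C : ℝ, ∀ u : ℝ, |f u| ≤ C

/-- `x` is a solution on `[s,∞)` of the neutral equation
`x'(t) - a(t) x'(g(t)) = -b(t) x(h(t))` with initial data `(φ, ψ)`. -/
def IsNeutralSolution1 (a b g h : ℝ → ℝ) (s : ℝ) (φ ψ x : ℝ → ℝ) : Prop :=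
  (∀ t ≤ s, x t = φ t) ∧
  (∀ t, s ≤ t → DifferentiableAt ℝ x t) ∧
  (∀ t1, s ≤ t1 → ∃ C : ℝ, ∀ t ∈ Set.Icc s t1, |deriv x t| ≤ C) ∧
  (∀ᵐ t : ℝ ∂volume, s ≤ t →
    Dfun x ψ s t - a t * Dfun x ψ s (g t) = -(b t * x (h t)))

/-- Uniform exponential stability of the neutral equation
`x'(t) - a(t) x'(g(t)) = -b(t) x(h(t))` for initial times in `[t0,∞)`. -/
def UnifExpStable1 (a b g h : ℝ → ℝ) (t0 : ℝ) : Prop :=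
  ∃ M > (0:ℝ), ∃ γ > (0:ℝ), ∀ s, t0 ≤ s → ∀ φ ψ x : ℝ → ℝ, Bdd φ → Bdd ψ →
    IsNeutralSolution1 a b g h s φ ψ x →
    ∀ t, s ≤ t →
      |x t| ≤ M * Real.exp (-γ * (t - s)) * ⨆ u : {u : ℝ // u ≤ s}, (|φ u.1| + |ψ u.1|)

/-- A differentiable function with bounded derivative which is a.e. nonpositive does not increase. -/
lemma aux_mono (w : ℝ → ℝ) (s T C : ℝ) (hsT : s ≤ T)
    (hd : ∀ t ∈ Set.Icc s T, DifferentiableAt ℝ w t)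
    (hC : ∀ t ∈ Set.Icc s T, |deriv w t| ≤ C)
    (hae : ∀ᵐ t : ℝ ∂volume, t ∈ Set.Ioc s T → deriv w t ≤ 0) : w T ≤ w s := by
  have hint : IntervalIntegrable (deriv w) volume s T := by
    rw [intervalIntegrable_iff_integrableOn_Ioc_of_le hsT]
    refine Measure.integrableOn_of_bounded (M := C) (by simp)
      (measurable_deriv w).aestronglyMeasurable ?_
    rw [ae_restrict_iff' measurableSet_Ioc]
    exact Filter.Eventually.of_forall fun t ht => hC t ⟨ht.1.le, ht.2⟩
  have h1 := intervalIntegral.integral_eq_sub_of_hasDerivAt (f := w) (f' := deriv w)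
    (a := s) (b := T) (fun t ht => by
      rw [Set.uIcc_of_le hsT] at ht
      exact (hd t ht).hasDerivAt) hint
  have h2 : ∫ t in s..T, deriv w t ≤ 0 := by
    rw [intervalIntegral.integral_of_le hsT]
    apply integral_nonpos_of_ae
    rw [Filter.EventuallyLE, ae_restrict_iff' measurableSet_Ioc]
    exact hae
  linarith

lemma aux_barrier (w : ℝ → ℝ) (s T C : ℝ) (hsT : s ≤ T)
    (hd : ∀ t ∈ Set.Icc s T, DifferentiableAt ℝ w t)
    (hC : ∀ t ∈ Set.Icc s T, |deriv w t| ≤ C)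
    (hs : w s ≤ 0)
    (hae : ∀ᵐ t : ℝ ∂volume, t ∈ Set.Icc s T → 0 < w t → deriv w t ≤ 0) : w T ≤ 0 := by
  by_contra hT
  push Not at hT
  have hcont : ContinuousOn w (Set.Icc s T) := fun t ht => (hd t ht).continuousAt.continuousWithinAt
  have hcl : IsCompact (Set.Icc s T ∩ w ⁻¹' Set.Iic 0) :=
    isCompact_Icc.of_isClosed_subset
      (hcont.preimage_isClosed_of_isClosed isClosed_Icc isClosed_Iic) Set.inter_subset_left
  obtain ⟨m, ⟨hm1, hm2⟩, hm3⟩ := hcl.exists_isGreatest ⟨s, ⟨le_rfl, hsT⟩, hs⟩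
  have hm2' : w m ≤ 0 := hm2
  have := aux_mono w m T C hm1.2 (fun t ht => hd t ⟨hm1.1.trans ht.1, ht.2⟩)
    (fun t ht => hC t ⟨hm1.1.trans ht.1, ht.2⟩) (by
      filter_upwards [hae] with t ht htm
      refine ht ⟨hm1.1.trans htm.1.le, htm.2⟩ ?_
      by_contra hw
      push Not at hw
      have := hm3 ⟨⟨hm1.1.trans htm.1.le, htm.2⟩, hw⟩
      linarith [htm.1])
  linarith

lemma aux_hasDeriv_E (γ s V t : ℝ) :
    HasDerivAt (fun t => V * exp (-γ * (t - s))) (-(γ * V) * exp (-γ * (t - s))) t := by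
  have h1 : HasDerivAt (fun t => -γ * (t - s)) (-γ * 1) t :=
    ((hasDerivAt_id t).sub_const s).const_mul (-γ)
  refine (h1.exp.const_mul V).congr_deriv ?_
  ring

lemma aux_E_le_one (γ s t : ℝ) (hγ : 0 < γ) (hst : s ≤ t) : exp (-γ * (t - s)) ≤ 1 := by
  rw [exp_le_one_iff]; nlinarith

/-- comparison with an exponential -/
lemma aux_comp (y b : ℝ → ℝ) (s T C γ α R V : ℝ) (hsT : s ≤ T) (hγ : 0 < γ)
    (hd : ∀ t ∈ Set.Icc s T, DifferentiableAt ℝ y t)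
    (hC : ∀ t ∈ Set.Icc s T, |deriv y t| ≤ C)
    (hs : y s ≤ V) (hV : 0 ≤ V) (hRV : R ≤ V) (hVR : γ * V ≤ α * (V - R)) (hα : 0 < α)
    (hae : ∀ᵐ t : ℝ ∂volume, t ∈ Set.Icc s T → α ≤ b t ∧
      deriv y t + b t * y t ≤ b t * (R * exp (-γ * (t - s)))) :
    y T ≤ V * exp (-γ * (T - s)) := by
  have hder : ∀ t ∈ Set.Icc s T, HasDerivAt (fun t => y t - V * exp (-γ * (t - s)))
      (deriv y t - -(γ * V) * exp (-γ * (t - s))) t := fun t ht =>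
    (hd t ht).hasDerivAt.sub (aux_hasDeriv_E γ s V t)
  have := aux_barrier (fun t => y t - V * exp (-γ * (t - s))) s T (C + γ * V) hsT
    (fun t ht => (hder t ht).differentiableAt)
    (fun t ht => by
      rw [(hder t ht).deriv]
      have h1 := aux_E_le_one γ s t hγ ht.1
      have h2 := exp_pos (-γ * (t - s))
      have h3 := abs_le.1 (hC t ht)
      have h4 : 0 ≤ γ * V := by positivity
      rw [abs_le]
      constructor <;> nlinarith)
    (by simpa using hs)
    (by
      filter_upwards [hae] with t ht htm hw
      obtain ⟨hb, h1⟩ := ht htm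
      rw [(hder t htm).deriv]
      have h2 := exp_pos (-γ * (t - s))
      set E := exp (-γ * (t - s))
      have hb0 : 0 < b t := by linarith
      have h3 : b t * (V * E) ≤ b t * y t := by
        apply mul_le_mul_of_nonneg_left _ hb0.le
        linarith
      have h4 : α * (V - R) ≤ b t * (V - R) :=
        mul_le_mul_of_nonneg_right hb (by linarith)
      have h5 : (γ * V) * E ≤ (b t * (V - R)) * E :=
        mul_le_mul_of_nonneg_right (hVR.trans h4) h2.le
      nlinarith)
  linarith

/-- a.e. exponential upper bound on the derivative is an everywhere bound -/
lemma aux_everywhere (y : ℝ → ℝ) (s T C γ L : ℝ) (hsT : s < T) (hγ : 0 < γ) (hL : 0 ≤ L)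
    (hd : ∀ t ∈ Set.Icc s T, DifferentiableAt ℝ y t)
    (hC : ∀ t ∈ Set.Icc s T, |deriv y t| ≤ C)
    (hae : ∀ᵐ t : ℝ ∂volume, t ∈ Set.Icc s T → deriv y t ≤ L * exp (-γ * (t - s))) :
    ∀ t ∈ Set.Icc s T, deriv y t ≤ L * exp (-γ * (t - s)) := by
  have hder : ∀ t ∈ Set.Icc s T, HasDerivAt (fun t => y t + (L / γ) * exp (-γ * (t - s)))
      (deriv y t - L * exp (-γ * (t - s))) t := fun t ht => by
    refine ((hd t ht).hasDerivAt.add (aux_hasDeriv_E γ s (L / γ) t)).congr_deriv ?_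
    field_simp
    ring
  have hanti : AntitoneOn (fun t => y t + (L / γ) * exp (-γ * (t - s))) (Set.Icc s T) := by
    intro u hu v hv huv
    refine aux_mono _ u v (C + L) huv
      (fun t ht => (hder t ⟨hu.1.trans ht.1, ht.2.trans hv.2⟩).differentiableAt) ?_ ?_
    · intro t ht
      have ht' : t ∈ Set.Icc s T := ⟨hu.1.trans ht.1, ht.2.trans hv.2⟩
      rw [(hder t ht').deriv]
      have h1 := aux_E_le_one γ s t hγ ht'.1
      have h2 := exp_pos (-γ * (t - s))
      have h3 := abs_le.1 (hC t ht')
      rw [abs_le]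
      constructor <;> nlinarith
    · filter_upwards [hae] with t ht htm
      have ht' : t ∈ Set.Icc s T := ⟨hu.1.trans htm.1.le, htm.2.trans hv.2⟩
      rw [(hder t ht').deriv]
      linarith [ht ht']
  intro t ht
  have h1 := hanti.derivWithin_nonpos (x := t)
  rw [(hder t ht).hasDerivWithinAt.derivWithin (uniqueDiffOn_Icc hsT t ht)] at h1
  linarith

lemma aux_shift (γ s u v σ : ℝ) (hγ : 0 < γ) (h : u - v ≤ σ) :
    exp (-γ * (v - s)) ≤ exp (γ * σ) * exp (-γ * (u - s)) := by
  rw [← exp_add, exp_le_exp]; nlinarith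

lemma aux_gamma (α σ τ A0 B P : ℝ) (hα : 0 < α) (hcond : (P + τ) * B < 1 - A0) :
    ∃ γ > (0:ℝ), γ < α ∧ A0 * exp (γ * σ) + B * exp (γ * τ) * ((α / (α - γ)) *
      (P * exp (γ * σ) + τ * exp (γ * τ))) < 1 := by
  have hc : ContinuousAt (fun γ : ℝ => A0 * exp (γ * σ) + B * exp (γ * τ) * ((α / (α - γ)) *
      (P * exp (γ * σ) + τ * exp (γ * τ)))) 0 := by
    have : α - 0 ≠ 0 := by simpa using hα.ne'
    fun_prop (disch := assumption)
  have h1 : ∀ᶠ γ in nhds (0:ℝ), A0 * exp (γ * σ) + B * exp (γ * τ) * ((α / (α - γ)) *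
      (P * exp (γ * σ) + τ * exp (γ * τ))) < 1 := by
    apply hc.eventually_lt_const
    simp [hα.ne']
    linarith
  have h2 := (h1.and (eventually_lt_nhds hα)).filter_mono (nhdsWithin_le_nhds (s := Set.Ioi 0))
  obtain ⟨γ, ⟨h3, h4⟩, h5⟩ := (h2.and self_mem_nhdsWithin).exists
  exact ⟨γ, h5, h4, h3⟩

/-- the main a priori estimate on `[s,T]` -/
lemma aux_step (a b g h : ℝ → ℝ) (s T γ σ τ α A0 B P N K C V R : ℝ) (φ ψ x : ℝ → ℝ)
    (hsT : s < T) (hγ : 0 < γ) (hτ : 0 < τ) (hα : 0 < α) (hA0 : 0 ≤ A0) (hB : 0 ≤ B) (hP : 0 ≤ P)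
    (hN : 0 ≤ N) (hK : 0 ≤ K)
    (hφ : ∀ u ≤ s, |φ u| ≤ N) (hψ : ∀ u ≤ s, |ψ u| ≤ N)
    (hx : ∀ t ≤ s, x t = φ t)
    (hd : ∀ t, s ≤ t → DifferentiableAt ℝ x t)
    (hC : ∀ t ∈ Set.Icc s T, |deriv x t| ≤ C)
    (hKb : ∀ t ∈ Set.Icc s T, |deriv x t| ≤ K * exp (-γ * (t - s)))
    (hae : ∀ᵐ t : ℝ ∂volume, t ∈ Set.Icc s T → (α ≤ b t ∧ |a t| ≤ A0 ∧ |b t| ≤ B ∧ |a t| / b t ≤ P)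
      ∧ (0 ≤ t - g t ∧ t - g t ≤ σ) ∧ (0 ≤ t - h t ∧ t - h t ≤ τ) ∧
      Dfun x ψ s t - a t * Dfun x ψ s (g t) = -(b t * x (h t)))
    (hR : R = (P * exp (γ * σ) + τ * exp (γ * τ)) * K + (P * exp (γ * σ) + 2 * exp (γ * τ)) * N)
    (hNV : N ≤ V) (hRV : R ≤ V) (hVR : γ * V ≤ α * (V - R)) :
    (∀ t ∈ Set.Icc s T, |x t| ≤ V * exp (-γ * (t - s))) ∧
    (∀ t ∈ Set.Icc s T, |deriv x t| ≤
      (A0 * (exp (γ * σ) * (K + N)) + B * (exp (γ * τ) * V)) * exp (-γ * (t - s))) := by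
  have hV : 0 ≤ V := hN.trans hNV
  -- bound on the delayed derivative
  have hDg : ∀ t ∈ Set.Icc s T, 0 ≤ t - g t → t - g t ≤ σ →
      |Dfun x ψ s (g t)| ≤ exp (γ * σ) * (K + N) * exp (-γ * (t - s)) := by
    intro t ht h0 h1
    have hsh := aux_shift γ s t (g t) σ hγ h1
    have hpos := exp_pos (-γ * (g t - s))
    unfold Dfun
    split_ifs with hsg
    · have := hKb (g t) ⟨hsg, by linarith [ht.2]⟩
      nlinarith
    · push Not at hsg
      have h2 := hψ (g t) hsg.le
      have h3 : 1 ≤ exp (-γ * (g t - s)) := by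
        rw [one_le_exp_iff]; nlinarith
      nlinarith
  -- bound on the increment
  have hinc : ∀ v u, s ≤ v → v ≤ u → u ≤ T → u - v ≤ τ →
      |x u - x v| ≤ τ * K * exp (γ * τ) * exp (-γ * (u - s)) := by
    intro v u hsv hvu huT hτ'
    have h1 := (convex_Icc v u).norm_image_sub_le_of_norm_deriv_le (f := x)
      (C := K * exp (-γ * (v - s))) (x := v) (y := u)
      (fun t ht => hd t (hsv.trans ht.1))
      (fun t ht => by
        refine (hKb t ⟨hsv.trans ht.1, ht.2.trans huT⟩).trans ?_
        apply mul_le_mul_of_nonneg_left _ hK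
        rw [exp_le_exp]; nlinarith [ht.1])
      ⟨le_rfl, hvu⟩ ⟨hvu, le_rfl⟩
    rw [Real.norm_eq_abs, Real.norm_eq_abs, abs_of_nonneg (by linarith : 0 ≤ u - v)] at h1
    have h2 := aux_shift γ s u v τ hγ hτ'
    calc |x u - x v| ≤ K * exp (-γ * (v - s)) * (u - v) := h1
      _ ≤ K * (exp (γ * τ) * exp (-γ * (u - s))) * τ := by
        gcongr
      _ = _ := by ring
  have hxh : ∀ t ∈ Set.Icc s T, 0 ≤ t - h t → t - h t ≤ τ →
      |x t - x (h t)| ≤ (τ * exp (γ * τ) * K + 2 * exp (γ * τ) * N) * exp (-γ * (t - s)) := by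
    intro t ht h0 h1
    rcases le_or_gt s (h t) with hs | hs
    · have := hinc (h t) t hs (by linarith) ht.2 h1
      have h5 : 0 ≤ 2 * exp (γ * τ) * N * exp (-γ * (t - s)) := by positivity
      linarith
    · have h2 := hinc s t le_rfl ht.1 ht.2 (by linarith)
      have h3 := hφ s le_rfl
      have h4 := hφ (h t) hs.le
      rw [← hx s le_rfl] at h3
      rw [← hx (h t) hs.le] at h4
      have h5 := aux_shift γ s t s τ hγ (by linarith)
      simp only [sub_self, mul_zero, exp_zero] at h5
      have h6 : |x t - x (h t)| ≤ |x t - x s| + |x s| + |x (h t)| := by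
        have e : x t - x (h t) = (x t - x s) + x s - x (h t) := by ring
        rw [e]
        exact (abs_sub _ _).trans (by gcongr; exact abs_add_le _ _)
      nlinarith
  have hCn : ∀ t ∈ Set.Icc s T, |deriv (-x) t| ≤ C := fun t ht => by
    rw [deriv.neg, abs_neg]; exact hC t ht
  -- the pointwise estimate
  have hpt : ∀ᵐ t : ℝ ∂volume, t ∈ Set.Icc s T → α ≤ b t ∧
      |deriv x t + b t * x t| ≤ b t * (R * exp (-γ * (t - s))) := by
    filter_upwards [hae] with t ht htm
    obtain ⟨⟨hb, ha, hbB, hP'⟩, ⟨hg0, hg1⟩, ⟨hh0, hh1⟩, heq⟩ := ht htm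
    refine ⟨hb, ?_⟩
    have hb0 : 0 < b t := by linarith
    have e1 : Dfun x ψ s t = deriv x t := by simp [Dfun, htm.1]
    rw [e1] at heq
    have e2 : deriv x t + b t * x t = a t * Dfun x ψ s (g t) + b t * (x t - x (h t)) := by
      linarith
    rw [e2]
    have h1 := hDg t htm hg0 hg1
    have h2 := hxh t htm hh0 hh1
    have h3 : |a t| ≤ b t * P := by
      rw [div_le_iff₀ hb0] at hP'; linarith
    calc |a t * Dfun x ψ s (g t) + b t * (x t - x (h t))|
        ≤ |a t| * |Dfun x ψ s (g t)| + b t * |x t - x (h t)| := by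
          refine (abs_add_le _ _).trans ?_
          rw [abs_mul, abs_mul, abs_of_pos hb0]
      _ ≤ (b t * P) * (exp (γ * σ) * (K + N) * exp (-γ * (t - s))) +
          b t * ((τ * exp (γ * τ) * K + 2 * exp (γ * τ) * N) * exp (-γ * (t - s))) := by
          gcongr
      _ = _ := by rw [hR]; ring
  have hxs : |x s| ≤ N := by rw [hx s le_rfl]; exact hφ s le_rfl
  have hxb : ∀ t ∈ Set.Icc s T, |x t| ≤ V * exp (-γ * (t - s)) := by
    intro t ht
    have hsub : ∀ u ∈ Set.Icc s t, u ∈ Set.Icc s T := fun u hu => ⟨hu.1, hu.2.trans ht.2⟩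
    rw [abs_le']
    constructor
    · refine aux_comp x b s t C γ α R V ht.1 hγ (fun u hu => hd u hu.1)
        (fun u hu => hC u (hsub u hu)) (by linarith [le_abs_self (x s)]) hV hRV hVR hα ?_
      filter_upwards [hpt] with u hu hut
      exact ⟨(hu (hsub u hut)).1, (le_abs_self _).trans (hu (hsub u hut)).2⟩
    · refine aux_comp (-x) b s t C γ α R V ht.1 hγ (fun u hu => (hd u hu.1).neg)
        (fun u hu => hCn u (hsub u hu)) (by
          simp only [Pi.neg_apply]; linarith [neg_abs_le (x s)]) hV hRV hVR hα ?_
      filter_upwards [hpt] with u hu hut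
      refine ⟨(hu (hsub u hut)).1, le_trans ?_ ((neg_le_abs _).trans (hu (hsub u hut)).2)⟩
      rw [deriv.neg, Pi.neg_apply]
      linarith
  refine ⟨hxb, ?_⟩
  have hdae : ∀ᵐ t : ℝ ∂volume, t ∈ Set.Icc s T → |deriv x t| ≤
      (A0 * (exp (γ * σ) * (K + N)) + B * (exp (γ * τ) * V)) * exp (-γ * (t - s)) := by
    filter_upwards [hae] with t ht htm
    obtain ⟨⟨hb, ha, hbB, hP'⟩, ⟨hg0, hg1⟩, ⟨hh0, hh1⟩, heq⟩ := ht htm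
    have e1 : Dfun x ψ s t = deriv x t := by simp [Dfun, htm.1]
    rw [e1] at heq
    have h1 := hDg t htm hg0 hg1
    have h2 : |x (h t)| ≤ exp (γ * τ) * V * exp (-γ * (t - s)) := by
      have hsh := aux_shift γ s t (h t) τ hγ hh1
      rcases le_or_gt s (h t) with hs | hs
      · have := hxb (h t) ⟨hs, by linarith [htm.2]⟩
        nlinarith
      · have h4 := hφ (h t) hs.le
        rw [← hx (h t) hs.le] at h4
        have h3 : 1 ≤ exp (-γ * (h t - s)) := by
          rw [one_le_exp_iff]; nlinarith
        nlinarith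
    have e2 : deriv x t = a t * Dfun x ψ s (g t) - b t * x (h t) := by linarith
    rw [e2]
    calc |a t * Dfun x ψ s (g t) - b t * x (h t)|
        ≤ |a t| * |Dfun x ψ s (g t)| + |b t| * |x (h t)| := by
          refine (abs_sub _ _).trans ?_
          rw [abs_mul, abs_mul]
      _ ≤ A0 * (exp (γ * σ) * (K + N) * exp (-γ * (t - s))) +
          B * (exp (γ * τ) * V * exp (-γ * (t - s))) := by
          gcongr
      _ = _ := by ring
  have hL : 0 ≤ A0 * (exp (γ * σ) * (K + N)) + B * (exp (γ * τ) * V) := by positivity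
  intro t ht
  rw [abs_le']
  constructor
  · refine aux_everywhere x s T C γ _ hsT hγ hL (fun u hu => hd u hu.1) hC ?_ t ht
    filter_upwards [hdae] with u hu hut
    exact (le_abs_self _).trans (hu hut)
  · have := aux_everywhere (-x) s T C γ _ hsT hγ hL (fun u hu => (hd u hu.1).neg) hCn (by
      filter_upwards [hdae] with u hu hut
      rw [deriv.neg]
      exact (neg_le_abs _).trans (hu hut)) t ht
    rwa [deriv.neg] at this

/-- Corollary 4.2: exponential stability test for
`x'(t) - a(t) x'(g(t)) = -b(t) x(h(t))`. -/
theorem corollary4_2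
    (t0 : ℝ) (ht0 : 0 ≤ t0) (σ τ : ℝ) (hσ : 0 < σ) (hτ : 0 < τ)
    (a b g h : ℝ → ℝ)
    (ham : Measurable a) (hbm : Measurable b) (hgm : Measurable g) (hhm : Measurable h)
    (hgdel : ∀ᵐ t : ℝ ∂volume, t0 ≤ t → 0 ≤ t - g t ∧ t - g t ≤ σ)
    (hhdel : ∀ᵐ t : ℝ ∂volume, t0 ≤ t → 0 ≤ t - h t ∧ t - h t ≤ τ)
    (α A0 B P : ℝ) (hα : 0 < α) (hA0 : 0 ≤ A0) (hA0' : A0 < 1)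
    (hB : 0 ≤ B) (hP : 0 ≤ P)
    (hae : ∀ᵐ t : ℝ ∂volume, t0 ≤ t →
      α ≤ b t ∧ |a t| ≤ A0 ∧ |b t| ≤ B ∧ |a t| / b t ≤ P)
    (hcond : (P + τ) * B < 1 - A0) :
    UnifExpStable1 a b g h t0 := by
  obtain ⟨γ, hγ, hγα, hq⟩ := aux_gamma α σ τ A0 B P hα hcond
  set r := α / (α - γ) with hr
  have hαγ : 0 < α - γ := by linarith
  have hr1 : 1 ≤ r := by rw [hr, le_div_iff₀ hαγ]; linarith
  have hr2 : γ * r = α * (r - 1) := by rw [hr]; field_simp; ring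
  set p := P * exp (γ * σ) + τ * exp (γ * τ) with hp
  set p' := P * exp (γ * σ) + 2 * exp (γ * τ) with hp'
  set q := A0 * exp (γ * σ) + B * exp (γ * τ) * (r * p) with hqd
  set c := A0 * exp (γ * σ) + B * exp (γ * τ) * (1 + r * p') with hcd
  have hp0 : 0 ≤ p := by positivity
  have hp0' : 0 ≤ p' := by positivity
  have hr0 : 0 ≤ r := by linarith
  have hc0 : 0 ≤ c := by positivity
  have hq1 : 0 < 1 - q := by linarith
  refine ⟨1 + r * (p * (c / (1 - q)) + p'), by positivity, γ, hγ, ?_⟩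
  intro s hs φ ψ x ⟨Cφ, hCφ⟩ ⟨Cψ, hCψ⟩ ⟨hx, hd, hbd, heq⟩ t hst
  set N := ⨆ u : {u : ℝ // u ≤ s}, (|φ u.1| + |ψ u.1|) with hNd
  have hbdd : BddAbove (Set.range fun u : {u : ℝ // u ≤ s} => |φ u.1| + |ψ u.1|) := by
    refine ⟨Cφ + Cψ, ?_⟩
    rintro _ ⟨u, rfl⟩
    exact add_le_add (hCφ _) (hCψ _)
  have hNle : ∀ u ≤ s, |φ u| + |ψ u| ≤ N := fun u hu => le_ciSup hbdd ⟨u, hu⟩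
  have hφ : ∀ u ≤ s, |φ u| ≤ N := fun u hu => by linarith [hNle u hu, abs_nonneg (ψ u)]
  have hψ : ∀ u ≤ s, |ψ u| ≤ N := fun u hu => by linarith [hNle u hu, abs_nonneg (φ u)]
  have hN : 0 ≤ N := (abs_nonneg _).trans (hφ s le_rfl)
  obtain ⟨T, hT⟩ : ∃ T, T = t + 1 := ⟨_, rfl⟩
  have hsT : s < T := by linarith
  obtain ⟨C, hC⟩ := hbd T hsT.le
  have hC0 : 0 ≤ C := (abs_nonneg _).trans (hC s ⟨le_rfl, hsT.le⟩)
  set S := (fun u => exp (γ * (u - s)) * |deriv x u|) '' Set.Icc s T with hS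
  have hSb : BddAbove S := by
    refine ⟨exp (γ * (T - s)) * C, ?_⟩
    rintro _ ⟨u, hu, rfl⟩
    have := hC u hu
    have := hu.2
    dsimp only
    gcongr
  have hSn : S.Nonempty := ⟨_, s, ⟨le_rfl, hsT.le⟩, rfl⟩
  have hee : ∀ u, exp (γ * (u - s)) * exp (-γ * (u - s)) = 1 := fun u => by
    rw [← exp_add]; simp
  have hKle : ∀ u ∈ Set.Icc s T, exp (γ * (u - s)) * |deriv x u| ≤ sSup S := fun u hu =>
    le_csSup hSb ⟨u, hu, rfl⟩
  set K := sSup S with hKd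
  have hK : 0 ≤ K := le_trans (by positivity) (hKle s ⟨le_rfl, hsT.le⟩)
  have hKb : ∀ u ∈ Set.Icc s T, |deriv x u| ≤ K * exp (-γ * (u - s)) := fun u hu => by
    have h1 := mul_le_mul_of_nonneg_right (hKle u hu) (exp_pos (-γ * (u - s))).le
    calc |deriv x u| = (exp (γ * (u - s)) * exp (-γ * (u - s))) * |deriv x u| := by
          rw [hee]; ring
      _ ≤ _ := by linarith
  have hR0 : 0 ≤ p * K + p' * N := by positivity
  obtain ⟨h1, h2⟩ := aux_step a b g h s T γ σ τ α A0 B P N K C (N + r * (p * K + p' * N))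
    (p * K + p' * N) φ ψ x hsT hγ hτ hα hA0 hB hP hN hK hφ hψ hx hd hC hKb (by
      filter_upwards [hgdel, hhdel, hae, heq] with u k1 k2 k3 k4 hu
      exact ⟨k3 (hs.trans hu.1), k1 (hs.trans hu.1), k2 (hs.trans hu.1), k4 hu.1⟩)
    rfl (by nlinarith) (by nlinarith) (by
      have : γ * (r * (p * K + p' * N)) = α * (r - 1) * (p * K + p' * N) := by
        rw [← hr2]; ring
      nlinarith)
  have hKq : K ≤ q * K + c * N := by
    apply csSup_le hSn
    rintro _ ⟨u, hu, rfl⟩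
    have h3 := mul_le_mul_of_nonneg_left (h2 u hu) (exp_pos (γ * (u - s))).le
    refine h3.trans (le_of_eq ?_)
    rw [mul_left_comm, hee, hqd, hcd]
    ring
  have hKN : K ≤ c / (1 - q) * N := by
    rw [div_mul_eq_mul_div, le_div_iff₀ hq1]; linarith
  refine (h1 t ⟨hst, by linarith⟩).trans ?_
  have h5 : N + r * (p * K + p' * N) ≤ N + r * (p * (c / (1 - q) * N) + p' * N) := by
    gcongr
  have h6 := mul_le_mul_of_nonneg_right h5 (exp_pos (-γ * (t - s))).le
  refine h6.trans (le_of_eq ?_)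
  ring
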